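/- arXiv:2406.14278 — 2 statements merged into one kernel-verified Lean document; each statement's English description precedes it below -/
import Mathlib

section
/- Let f be a non-negative, symmetric, submodular set function on a finite ground set N, let S₀ ⊆ N, and let S = T_m be the output of the deletion process applied to S₀ with any enumeration of S₀. Then for every T ⊆ N we have f(S ∪ T) ≥ f(T) − f(S). -/
/-- The deletion process: starting from `S₀`, visit the elements of the list `l` in order,
and delete an element whenever its removal does not decrease the value of `f`
(i.e. when `f T − f (T \ {v}) < 0`). -/
noncomputable def deleteProcess {N : Type*} [DecidableEq N] (f : Finset N → ℝ) (S₀ : Finset N)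
    (l : List N) : Finset N :=
  l.foldl (fun T v => if f T - f (T.erase v) < 0 then T.erase v else T) S₀

theorem deleteProcess_subset {N : Type*} [DecidableEq N] (f : Finset N → ℝ)
    (S₀ : Finset N) (l : List N) : deleteProcess f S₀ l ⊆ S₀ := by
  unfold deleteProcess
  induction l generalizing S₀ with
  | nil => exact Finset.Subset.refl _
  | cons v l ih =>
    rw [List.foldl_cons]
    split_ifs
    · exact (ih _).trans (Finset.erase_subset _ _)
    · exact ih _

/-- A submodular function does not increase when a processed element is removed from
a subset of the output of the deletion process. -/
theorem apply_erase_le_of_subset_deleteProcess {N : Type*} [DecidableEq N] {f : Finset N → ℝ}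
    (hsubmod : ∀ A B : Finset N, f (A ∪ B) + f (A ∩ B) ≤ f A + f B)
    (S₀ : Finset N) (l : List N) {B : Finset N} (hB : B ⊆ deleteProcess f S₀ l)
    {u : N} (hu : u ∈ B) (hul : u ∈ l) : f (B.erase u) ≤ f B := by
  induction l generalizing S₀ with
  | nil => simp at hul
  | cons v l ih =>
    by_cases h : f S₀ - f (S₀.erase v) < 0
    · have hstep : deleteProcess f S₀ (v :: l) = deleteProcess f (S₀.erase v) l := by
        simp only [deleteProcess, List.foldl_cons, if_pos h]
      rw [hstep] at hB
      have huv : u ≠ v := Finset.ne_of_mem_erase (deleteProcess_subset f _ l (hB hu))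
      exact ih _ hB ((List.mem_cons.1 hul).resolve_left huv)
    · have hstep : deleteProcess f S₀ (v :: l) = deleteProcess f S₀ l := by
        simp only [deleteProcess, List.foldl_cons, if_neg h]
      rw [hstep] at hB
      rcases List.mem_cons.1 hul with rfl | hul
      · have hBS := hB.trans (deleteProcess_subset f S₀ l)
        have hunion : B ∪ S₀.erase u = S₀ := by grind
        have hinter : B ∩ S₀.erase u = B.erase u := by grind
        have hsub := hsubmod B (S₀.erase u)
        rw [hunion, hinter] at hsub
        linarith
      · exact ih _ hB hul

theorem apply_sdiff_le_of_apply_erase_le {N : Type*} [DecidableEq N] {f : Finset N → ℝ}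
    {S : Finset N} (h : ∀ B ⊆ S, ∀ u ∈ B, f (B.erase u) ≤ f B) (T : Finset N) :
    f (S \ T) ≤ f S := by
  induction T using Finset.induction_on with
  | empty => simp
  | insert a T _ ih =>
    rw [Finset.sdiff_insert]
    by_cases ha : a ∈ S \ T
    · exact (h _ Finset.sdiff_subset a ha).trans ih
    · rwa [Finset.erase_eq_of_notMem ha]

/-- Let `f` be a non-negative, symmetric, submodular set function on a
finite ground set `N`, `S₀ ⊆ N`, and let `S = T_m` be the output of the deletion process
applied to `S₀` with any enumeration of `S₀`. Then for every `T ⊆ N`,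
`f (S ∪ T) ≥ f T − f S`. -/
theorem deleteProcess_union_lower_bound
    {N : Type*} [Fintype N] [DecidableEq N] (f : Finset N → ℝ)
    (hnonneg : ∀ A : Finset N, 0 ≤ f A)
    (hsym : ∀ A : Finset N, f A = f Aᶜ)
    (hsubmod : ∀ A B : Finset N, f (A ∪ B) + f (A ∩ B) ≤ f A + f B)
    (S₀ : Finset N) (l : List N) (hnodup : l.Nodup) (henum : l.toFinset = S₀) :
    ∀ T : Finset N,
      f (deleteProcess f S₀ l ∪ T) ≥ f T - f (deleteProcess f S₀ l) := by
  intro T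
  set S := deleteProcess f S₀ l
  have hmono : f (S \ T) ≤ f S := by
    refine apply_sdiff_le_of_apply_erase_le (fun B hB u hu => ?_) T
    refine apply_erase_le_of_subset_deleteProcess hsubmod S₀ l hB hu ?_
    rw [← List.mem_toFinset, henum]
    exact deleteProcess_subset f S₀ l (hB hu)
  have hinter : (S ∪ T) ∩ (S \ T)ᶜ = T := by
    ext x
    simp only [Finset.mem_inter, Finset.mem_union, Finset.mem_compl, Finset.mem_sdiff]
    tauto
  have hsub := hsubmod (S ∪ T) (S \ T)ᶜ
  rw [hinter, ← hsym (S \ T)] at hsub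
  linarith [hnonneg ((S ∪ T) ∪ (S \ T)ᶜ)]
end

section
/- Let f be a non-negative, symmetric, submodular set function on a finite ground set N, let k ≥ 3 be an integer, ε ∈ (0, 1), K = ⌈(k/3)·ln(1/ε)⌉, and let O ⊆ N. Suppose (S_i)_{i=0}^{K} are subsets of N with |S_i| = k for all i, f(S₀) ≥ 0, and for each i ∈ {1,…,K}: (i) there is a set B_i ⊆ N \ S_{i−1} with |B_i| = k and Σ_{u∈B_i} f(u | S_{i−1}) ≥ Σ_{u∈O\S_{i−1}} f(u | S_{i−1}); (ii) there is a bijection g_i : B_i → S_{i−1}; (iii) f(S_i) ≥ max_{u∈B_i} f((S_{i−1} ∪ {u}) \ {g_i(u)}); and (iv) f(R) ≤ f(S_i) for every R ⊆ S_i, and the same holds for S₀. Then f(S_K) ≥ ((1 − ε)/3)·f(O). -/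
/-- A submodular function gains from adding a set at most the sum of the single marginals. -/
theorem submodular_union_sub_le_sum {N : Type*} [DecidableEq N] {f : Finset N → ℝ}
    (hf : ∀ A B : Finset N, f (A ∪ B) + f (A ∩ B) ≤ f A + f B) (S T : Finset N) :
    f (S ∪ T) - f S ≤ ∑ u ∈ T, (f (insert u S) - f S) := by
  induction T using Finset.induction_on with
  | empty => simp
  | insert a T ha ih =>
    rw [Finset.sum_insert ha]
    by_cases haS : a ∈ S
    · have h1 : S ∪ insert a T = S ∪ T := by grind
      have h2 : insert a S = S := Finset.insert_eq_of_mem haS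
      rw [h1, h2]
      linarith
    · have h := hf (S ∪ T) (insert a S)
      have h1 : (S ∪ T) ∪ insert a S = S ∪ insert a T := by grind
      have h2 : (S ∪ T) ∩ insert a S = S := by grind
      rw [h1, h2] at h
      linarith

/-- The losses of a submodular function under single deletions from `S` of the elements
of `T ⊆ S` sum to at most `f T - f ∅`. -/
theorem submodular_sum_sub_erase_le {N : Type*} [DecidableEq N] {f : Finset N → ℝ}
    (hf : ∀ A B : Finset N, f (A ∪ B) + f (A ∩ B) ≤ f A + f B) {S T : Finset N} (hT : T ⊆ S) :
    ∑ v ∈ T, (f S - f (S.erase v)) ≤ f T - f ∅ := by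
  induction T using Finset.induction_on with
  | empty => simp
  | insert a T ha ih =>
    rw [Finset.sum_insert ha]
    have h := hf (insert a T) (S.erase a)
    have h1 : insert a T ∪ S.erase a = S := by grind
    have h2 : insert a T ∩ S.erase a = T := by grind
    rw [h1, h2] at h
    linarith [ih ((Finset.subset_insert a T).trans hT)]

/-- A symmetric submodular function is posimodular. -/
theorem symmetric_submodular_sdiff_add_sdiff_le {N : Type*} [Fintype N] [DecidableEq N]
    {f : Finset N → ℝ} (hsym : ∀ A : Finset N, f A = f Aᶜ)
    (hf : ∀ A B : Finset N, f (A ∪ B) + f (A ∩ B) ≤ f A + f B) (A B : Finset N) :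
    f (A \ B) + f (B \ A) ≤ f A + f B := by
  have h := hf A Bᶜ
  have h1 : (A ∪ Bᶜ)ᶜ = B \ A := by ext; simp [and_comm]
  have h2 : A ∩ Bᶜ = A \ B := by ext; simp
  rw [hsym (A ∪ Bᶜ), h1, h2, ← hsym B] at h
  linarith

/-- The best swap along a bijection `g : B → S` gains at least `(f O - 3 f S) / |S|`,
when no subset of `S` has a larger value than `S`. -/
theorem symmetric_submodular_swap_gain {N : Type*} [Fintype N] [DecidableEq N]
    {f : Finset N → ℝ} (hnonneg : ∀ A : Finset N, 0 ≤ f A) (hsym : ∀ A : Finset N, f A = f Aᶜ)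
    (hf : ∀ A B : Finset N, f (A ∪ B) + f (A ∩ B) ≤ f A + f B)
    {O S B : Finset N} {g : N → N} {c : ℝ} (hdel : ∀ R ⊆ S, f R ≤ f S)
    (hdisj : Disjoint B S)
    (hsum : ∑ u ∈ O \ S, (f (insert u S) - f S) ≤ ∑ u ∈ B, (f (insert u S) - f S))
    (hbij : Set.BijOn g (B : Set N) (S : Set N))
    (hswap : ∀ u ∈ B, f ((insert u S).erase (g u)) ≤ c) :
    f O - 3 * f S ≤ B.card * (c - f S) := by
  have hterm : ∀ u ∈ B,
      (f (insert u S) - f S) - (f S - f (S.erase (g u))) ≤ c - f S := by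
    intro u hu
    have huS : u ∉ S := Finset.disjoint_left.mp hdisj hu
    have hgS : g u ∈ S := hbij.mapsTo hu
    have h := hf ((insert u S).erase (g u)) S
    have h1 : (insert u S).erase (g u) ∪ S = insert u S := by grind
    have h2 : (insert u S).erase (g u) ∩ S = S.erase (g u) := by grind
    rw [h1, h2] at h
    linarith [hswap u hu]
  have htotal := Finset.sum_le_sum hterm
  rw [Finset.sum_sub_distrib, Finset.sum_const, nsmul_eq_mul] at htotal
  have hreindex : ∑ u ∈ B, (f S - f (S.erase (g u))) = ∑ v ∈ S, (f S - f (S.erase v)) :=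
    Finset.sum_bij (fun u _ => g u) (fun _ hu => hbij.mapsTo hu)
      (fun _ h₁ _ h₂ h => hbij.injOn h₁ h₂ h)
      (fun v hv => by
        obtain ⟨u, hu, rfl⟩ := hbij.surjOn hv
        exact ⟨u, hu, rfl⟩) (fun _ _ => rfl)
  have hloss := submodular_sum_sub_erase_le hf (Finset.Subset.refl S)
  have hgain := submodular_union_sub_le_sum hf S (O \ S)
  rw [Finset.union_sdiff_self_eq_union] at hgain
  have hposi := symmetric_submodular_sdiff_add_sdiff_le hsym hf (S ∪ O) (S \ O)
  have h1 : (S ∪ O) \ (S \ O) = O := by grind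
  rw [h1] at hposi
  linarith [hnonneg ∅, hnonneg ((S \ O) \ (S ∪ O)), hdel (S \ O) Finset.sdiff_subset]

/-- A contraction by `1 - a / k` per round shrinks below `ε` within `(k / a) log (1 / ε)`
rounds. -/
theorem one_sub_div_pow_le_of_mul_log_le {a k ε : ℝ} (ha : 0 < a) (hak : a ≤ k) (hε : 0 < ε)
    {n : ℕ} (hn : k / a * Real.log (1 / ε) ≤ n) : (1 - a / k) ^ n ≤ ε := by
  have hk : 0 < k := ha.trans_le hak
  have hbase : 0 ≤ 1 - a / k := by
    rw [sub_nonneg, div_le_one hk]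
    exact hak
  calc (1 - a / k) ^ n ≤ Real.exp (-(a / k)) ^ n :=
        pow_le_pow_left₀ hbase (Real.one_sub_le_exp_neg _) n
    _ = Real.exp (-(a / k * n)) := by rw [← Real.exp_nat_mul]; ring_nf
    _ ≤ Real.exp (Real.log ε) := by
        have h := mul_le_mul_of_nonneg_left hn (div_pos ha hk).le
        have h1 : a / k * (k / a * Real.log (1 / ε)) = -Real.log ε := by
          rw [one_div, Real.log_inv]
          field_simp
        exact Real.exp_le_exp.mpr (by linarith)
    _ = ε := Real.exp_log hε


/-- Analysis of the greedy exchange algorithm (with the Delete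
procedure) for symmetric submodular maximization under a matroid constraint of rank `k`.
For each round `i ∈ {1, …, K}`: (i) `B i` is a set of size `k` disjoint from `S (i−1)`
whose total marginal value dominates that of `O \ S (i−1)`; (ii) `g i` is a bijection
from `B i` to `S (i−1)`; (iii) `f (S i)` is at least the best swap value
`max_{u ∈ B i} f((S (i−1) ∪ {u}) \ {g i u})`; and (iv) `f R ≤ f (S i)` for every
`R ⊆ S i` (and the same for `S 0`). Then `f (S K) ≥ ((1 − ε)/3)·f O`. -/
theorem greedy_matroid_guarantee
    {N : Type*} [Fintype N] [DecidableEq N] (f : Finset N → ℝ)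
    (hnonneg : ∀ A : Finset N, 0 ≤ f A)
    (hsym : ∀ A : Finset N, f A = f Aᶜ)
    (hsubmod : ∀ A B : Finset N, f (A ∪ B) + f (A ∩ B) ≤ f A + f B)
    (k : ℕ) (hk : 3 ≤ k) (ε : ℝ) (hε : ε ∈ Set.Ioo (0 : ℝ) 1)
    (K : ℕ) (hK : K = ⌈((k : ℝ) / 3) * Real.log (1 / ε)⌉₊)
    (O : Finset N)
    (S : ℕ → Finset N) (hScard : ∀ i ≤ K, (S i).card = k)
    (hS0nonneg : f (S 0) ≥ 0)
    (hS0delete : ∀ R ⊆ S 0, f R ≤ f (S 0))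
    (B : ℕ → Finset N) (g : ℕ → N → N)
    (hBdisj : ∀ i, 1 ≤ i → i ≤ K → Disjoint (B i) (S (i - 1)))
    (hBcard : ∀ i, 1 ≤ i → i ≤ K → (B i).card = k)
    (hBsum : ∀ i, 1 ≤ i → i ≤ K →
      ∑ u ∈ B i, (f (insert u (S (i - 1))) - f (S (i - 1))) ≥
        ∑ u ∈ O \ S (i - 1), (f (insert u (S (i - 1))) - f (S (i - 1))))
    (hbij : ∀ i, 1 ≤ i → i ≤ K → Set.BijOn (g i) (B i : Set N) (S (i - 1) : Set N))
    (hswap : ∀ i, 1 ≤ i → i ≤ K → ∀ u ∈ B i,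
      f (S i) ≥ f ((insert u (S (i - 1))).erase (g i u)))
    (hdelete : ∀ i, 1 ≤ i → i ≤ K → ∀ R ⊆ S i, f R ≤ f (S i)) :
    f (S K) ≥ ((1 - ε) / 3) * f O := by
  have hk3 : (3 : ℝ) ≤ k := by exact_mod_cast hk
  have hkpos : (0 : ℝ) < k := by linarith
  have hbase : 0 ≤ 1 - 3 / (k : ℝ) := by
    rw [sub_nonneg, div_le_one hkpos]
    exact hk3
  have hdel : ∀ i ≤ K, ∀ R ⊆ S i, f R ≤ f (S i) := by
    intro i hi
    rcases Nat.eq_zero_or_pos i with rfl | hpos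
    · exact hS0delete
    · exact hdelete i hpos hi
  have hgap : ∀ i ≤ K, f O - 3 * f (S i) ≤ (1 - 3 / (k : ℝ)) ^ i * f O := by
    intro i
    induction i with
    | zero => intro _; simp only [pow_zero]; linarith
    | succ i ih =>
      intro hi
      have h1 : 1 ≤ i + 1 := Nat.le_add_left 1 i
      have hstep : f O - 3 * f (S i) ≤ (B (i + 1)).card * (f (S (i + 1)) - f (S i)) :=
        symmetric_submodular_swap_gain hnonneg hsym hsubmod (hdel i (by omega))
          (hBdisj (i + 1) h1 hi) (hBsum (i + 1) h1 hi) (hbij (i + 1) h1 hi)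
          (hswap (i + 1) h1 hi)
      rw [hBcard (i + 1) h1 hi, ← div_le_iff₀' hkpos] at hstep
      calc f O - 3 * f (S (i + 1))
          ≤ (f O - 3 * f (S i)) - 3 * ((f O - 3 * f (S i)) / k) := by linarith
        _ = (1 - 3 / (k : ℝ)) * (f O - 3 * f (S i)) := by ring
        _ ≤ (1 - 3 / (k : ℝ)) * ((1 - 3 / (k : ℝ)) ^ i * f O) :=
            mul_le_mul_of_nonneg_left (ih (by omega)) hbase
        _ = (1 - 3 / (k : ℝ)) ^ (i + 1) * f O := by ring
  have hpow : (1 - 3 / (k : ℝ)) ^ K ≤ ε :=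
    one_sub_div_pow_le_of_mul_log_le three_pos hk3 hε.1 (hK ▸ Nat.le_ceil _)
  linarith [hgap K le_rfl, mul_le_mul_of_nonneg_right hpow (hnonneg O)]
end
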